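/- Let n ≥ 2, 0 < p < ∞, α > −1, and let μ be a positive Borel measure on ℝ^{n+1}_+. Then the following are equivalent: (i) there is C > 0 with μ(Q_w) ≤ C·s^{n+1+α} for every w = (y,s) ∈ ℝ^{n+1}_+; (ii) A_α^p is continuously embedded into L^p(ℝ^{n+1}_+, dμ), i.e. there is C' > 0 such that ∫_{ℝ^{n+1}_+} |f(z)|^p dμ(z) ≤ C' ‖f‖_{A_α^p}^p for every f ∈ A_α^p. -/

import Mathlib

open MeasureTheory Real Set
open scoped ENNReal

noncomputable section

abbrev Euc (N : ℕ) : Type := EuclideanSpace ℝ (Fin N)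

/-- The point `(x, t) ∈ ℝ^{n+1}`. -/
def pt {n : ℕ} (x : Euc n) (t : ℝ) : Euc (n + 1) :=
  (EuclideanSpace.equiv (Fin (n + 1)) ℝ).symm (Fin.snoc (fun i => x i) t)

/-- horizontal part of a point of ℝ^{n+1} -/
def xp {n : ℕ} (z : Euc (n + 1)) : Euc n :=
  (EuclideanSpace.equiv (Fin n) ℝ).symm (fun i => z i.castSucc)

/-- vertical part of a point of ℝ^{n+1} -/
def tp {n : ℕ} (z : Euc (n + 1)) : ℝ := z (Fin.last n)

/-- The upper half space ℝ^{n+1}_+. -/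
def upperHS (n : ℕ) : Set (Euc (n + 1)) := {z | 0 < tp z}

/-- |z - w̄| where z = (x,t), w̄ = (y, -s): Euclidean distance -/
def dB {n : ℕ} (x : Euc n) (t : ℝ) (y : Euc n) (s : ℝ) : ℝ :=
  dist (pt x t) (pt y (-s))

/-- the measure t^λ dx dt on ℝ^n × (0,∞), identified with ℝ^{n+1}_+ -/
def mLam (n : ℕ) (l : ℝ) : Measure (Euc n × ℝ) :=
  ((volume : Measure (Euc n)).prod ((volume : Measure ℝ).restrict (Ioi 0))).withDensity
    (fun zt => ENNReal.ofReal (zt.2 ^ l))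

/-- second derivative of `f` at `z` along direction `v` -/
def d2 {V : Type*} [NormedAddCommGroup V] [NormedSpace ℝ V] (f : V → ℝ) (z v : V) : ℝ :=
  iteratedFDeriv ℝ 2 f z ![v, v]

/-- `f` is harmonic on a subset of ℝ^N : twice continuously differentiable with
vanishing Laplacian. -/
def HarmonicOnE {N : ℕ} (f : Euc N → ℝ) (s : Set (Euc N)) : Prop :=
  ContDiffOn ℝ 2 f s ∧ ∀ z ∈ s, ∑ i, d2 f z (EuclideanSpace.single i 1) = 0

/-- `f` is harmonic on (ℝ^{n+1}_+)^m, viewed as an open subset of ℝ^{m(n+1)}. -/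
def HarmonicOnM {n m : ℕ} (f : (Fin m → Euc (n + 1)) → ℝ) : Prop :=
  ContDiffOn ℝ 2 f {z | ∀ j, z j ∈ upperHS n} ∧
  ∀ z ∈ {z : Fin m → Euc (n + 1) | ∀ j, z j ∈ upperHS n},
    ∑ j, ∑ i, d2 f z (Function.update (0 : Fin m → Euc (n + 1)) j (EuclideanSpace.single i 1)) = 0

/-- `f` is harmonic in each variable separately on (ℝ^{n+1}_+)^m -/
def HarmonicSep {n m : ℕ} (f : (Fin m → Euc (n + 1)) → ℝ) : Prop :=
  ∀ (j : Fin m) (z : Fin m → Euc (n + 1)), (∀ k, z k ∈ upperHS n) →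
    HarmonicOnE (fun w => f (Function.update z j w)) (upperHS n)

/-- the closed cube centered at (y,s) with side length s -/
def Qcube {n : ℕ} (y : Euc n) (s : ℝ) : Set (Euc (n + 1)) :=
  {z | (∀ i : Fin n, |z (Fin.castSucc i) - y i| ≤ s / 2) ∧ |tp z - s| ≤ s / 2}

/-- the A^p_λ (quasi)-norm, raised to the power p -/
def normAp (n : ℕ) (f : Euc (n + 1) → ℝ) (p l : ℝ) : ℝ≥0∞ :=
  ∫⁻ zt : Euc n × ℝ, ENNReal.ofReal (|f (pt zt.1 zt.2)| ^ p) ∂(mLam n l)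

/-- membership in the harmonic Bergman space A^p_λ -/
def memAp (n : ℕ) (f : Euc (n + 1) → ℝ) (p l : ℝ) : Prop :=
  HarmonicOnE f (upperHS n) ∧ normAp n f p l < ⊤

/-- Truncated powers `max 0 x ^ (k + 2)` are differentiable. -/
lemma hasDerivAt_max_zero_pow (k : ℕ) (x : ℝ) :
    HasDerivAt (fun x : ℝ => (max 0 x) ^ (k + 2)) ((k + 2 : ℝ) * (max 0 x) ^ (k + 1)) x := by
  rcases lt_trichotomy x 0 with h | h | h
  · have : (fun x : ℝ => (max 0 x) ^ (k + 2)) =ᶠ[nhds x] fun _ => 0 := by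
      filter_upwards [Iio_mem_nhds h] with y hy
      simp [max_eq_left (mem_Iio.1 hy).le]
    rw [max_eq_left h.le]
    simpa using (hasDerivAt_const x (0 : ℝ)).congr_of_eventuallyEq this
  · subst h
    simp only [max_self, ne_eq, Nat.add_eq_zero_iff, one_ne_zero, and_false, not_false_eq_true,
      zero_pow, mul_zero]
    rw [hasDerivAt_iff_isLittleO_nhds_zero]
    simp only [zero_add, max_self, ne_eq, Nat.add_eq_zero_iff, OfNat.ofNat_ne_zero, and_false,
      not_false_eq_true, zero_pow, sub_zero, smul_zero]
    have h1 : (fun x : ℝ => (max 0 x) ^ (k + 2)) =O[nhds 0] fun x : ℝ => x ^ (k + 2) := by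
      refine Asymptotics.IsBigO.of_bound 1 (Filter.Eventually.of_forall fun y => ?_)
      simp only [norm_pow, one_mul]
      gcongr
      rw [Real.norm_eq_abs, Real.norm_eq_abs, abs_of_nonneg (le_max_left _ _)]
      exact max_le (abs_nonneg _) (le_abs_self _)
    refine h1.trans_isLittleO ?_
    exact Asymptotics.isLittleO_pow_id (by omega)
  · have : (fun x : ℝ => (max 0 x) ^ (k + 2)) =ᶠ[nhds x] fun x => x ^ (k + 2) := by
      filter_upwards [Ioi_mem_nhds h] with y hy
      rw [max_eq_right (le_of_lt hy)]
    rw [max_eq_right h.le]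
    simpa using (hasDerivAt_pow (k + 2) x).congr_of_eventuallyEq this

section MeanValue

variable {N : ℕ}

/-- The compactly supported bump `(1 - ‖w‖²)₊ ^ k`. -/
def bump (k : ℕ) (w : Euc N) : ℝ := (max 0 (1 - ‖w‖ ^ 2)) ^ k

lemma continuous_bump (k : ℕ) : Continuous (bump k : Euc N → ℝ) := by
  unfold bump; fun_prop

lemma bump_nonneg (k : ℕ) (w : Euc N) : 0 ≤ bump k w := by
  unfold bump; positivity

lemma bump_le_one (k : ℕ) (w : Euc N) : bump k w ≤ 1 :=
  pow_le_one₀ (le_max_left _ _) (max_le zero_le_one (by nlinarith [sq_nonneg ‖w‖]))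

lemma support_bump_subset {k : ℕ} (hk : k ≠ 0) :
    Function.support (bump k : Euc N → ℝ) ⊆ Metric.closedBall 0 1 := by
  intro w hw
  by_contra h
  apply hw
  simp only [Metric.mem_closedBall, dist_zero_right, not_le] at h
  unfold bump
  rw [max_eq_left (by nlinarith), zero_pow hk]

lemma tsupport_bump_subset {k : ℕ} (hk : k ≠ 0) :
    tsupport (bump k : Euc N → ℝ) ⊆ Metric.closedBall 0 1 :=
  closure_minimal (support_bump_subset hk) Metric.isClosed_closedBall

lemma hasLineDerivAt_bump (k : ℕ) (w : Euc N) (i : Fin N) :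
    HasLineDerivAt ℝ (bump (k + 2) : Euc N → ℝ)
      (-2 * (k + 2 : ℝ) * bump (k + 1) w * w i) w (EuclideanSpace.single i 1) := by
  have h1 : HasFDerivAt (fun w : Euc N => 1 - ‖w‖ ^ 2) (-(2 • innerSL ℝ w)) w := by
    simpa using (hasStrictFDerivAt_norm_sq w).hasFDerivAt.const_sub 1
  have h2 := ((hasDerivAt_max_zero_pow k (1 - ‖w‖ ^ 2)).comp_hasFDerivAt w h1).hasLineDerivAt
    (EuclideanSpace.single i 1)
  convert! h2 using 1
  simp [bump, EuclideanSpace.inner_single_right]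
  ring

/-- A function supported in a compact set and continuous on it, times a bump, is integrable. -/
lemma integrable_bump_mul {k : ℕ} (hk : k ≠ 0) {g : Euc N → ℝ}
    (hg : ContinuousOn g (Metric.closedBall 0 1)) :
    Integrable (fun w => bump k w * g w) := by
  rw [← integrableOn_iff_integrable_of_support_subset (s := Metric.closedBall 0 1)]
  · exact ((continuous_bump k).continuousOn.mul hg).integrableOn_compact
      (isCompact_closedBall _ _)
  · exact (Function.support_mul_subset_left _ _).trans (support_bump_subset hk)

lemma fderiv_apply_eq_sum (L : Euc N →L[ℝ] ℝ) (w : Euc N) :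
    L w = ∑ i, w i * L (EuclideanSpace.single i 1) := by
  conv_lhs => rw [← (EuclideanSpace.basisFun (Fin N) ℝ).sum_repr w]
  simp

variable {f : Euc N → ℝ} {z : Euc N} {R : ℝ}

lemma add_smul_mem_ball {ρ : ℝ} (hρ : |ρ| < R) {w : Euc N} (hw : w ∈ Metric.closedBall 0 1) :
    z + ρ • w ∈ Metric.ball z R := by
  simp only [Metric.mem_closedBall, dist_zero_right] at hw
  simp only [Metric.mem_ball, dist_self_add_left, norm_smul, Real.norm_eq_abs]
  nlinarith [abs_nonneg ρ]

lemma integral_bump_mul_fderiv_eq_zero (hf : HarmonicOnE f (Metric.ball z R)) {ρ : ℝ}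
    (hρ : |ρ| < R) :
    ∫ w : Euc N, bump 2 w * fderiv ℝ f (z + ρ • w) w = 0 := by
  have hmaps : MapsTo (fun w : Euc N => z + ρ • w) (Metric.closedBall 0 1) (Metric.ball z R) :=
    fun w hw => add_smul_mem_ball hρ hw
  have hcd : ∀ y ∈ Metric.ball z R, ContDiffAt ℝ 2 f y := fun y hy =>
    hf.1.contDiffAt (Metric.isOpen_ball.mem_nhds hy)
  have hd1 : ContDiffOn ℝ 1 (fderiv ℝ f) (Metric.ball z R) := fun y hy =>
    ((hcd y hy).fderiv_right (m := 1) (by norm_num)).contDiffWithinAt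
  have hd2 : ContinuousOn (fderiv ℝ (fderiv ℝ f)) (Metric.ball z R) :=
    hd1.continuousOn_fderiv_of_isOpen Metric.isOpen_ball le_rfl
  have haff : Continuous fun w : Euc N => z + ρ • w := by fun_prop
  let e : Fin N → Euc N := fun i => EuclideanSpace.single i 1
  have hg : ∀ i, ContinuousOn (fun w => fderiv ℝ f (z + ρ • w) (e i)) (Metric.closedBall 0 1) :=
    fun i => (hd1.continuousOn.comp haff.continuousOn hmaps).clm_apply continuousOn_const
  have hg' : ∀ i, ContinuousOn (fun w => fderiv ℝ (fderiv ℝ f) (z + ρ • w) (e i) (e i))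
      (Metric.closedBall 0 1) := fun i =>
    ((hd2.comp haff.continuousOn hmaps).clm_apply continuousOn_const).clm_apply continuousOn_const
  have hwi : ∀ i : Fin N, Continuous fun w : Euc N => w i := fun i => by fun_prop
  have hI1 : ∀ i, Integrable fun w => bump 2 w * (w i * fderiv ℝ f (z + ρ • w) (e i)) := fun i =>
    integrable_bump_mul two_ne_zero ((hwi i).continuousOn.mul (hg i))
  have hI2 : ∀ i, Integrable fun w =>
      bump 3 w * (ρ * fderiv ℝ (fderiv ℝ f) (z + ρ • w) (e i) (e i)) := fun i =>
    integrable_bump_mul three_ne_zero (continuousOn_const.mul (hg' i))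
  have key : ∀ i, ∫ w : Euc N, bump 3 w * (ρ * fderiv ℝ (fderiv ℝ f) (z + ρ • w) (e i) (e i))
      = 6 * ∫ w : Euc N, bump 2 w * (w i * fderiv ℝ f (z + ρ • w) (e i)) := by
    intro i
    have := integral_bilinear_hasLineDerivAt_right_eq_neg_left_of_integrable
      (μ := (volume : Measure (Euc N))) (f := bump 3)
      (f' := fun w => -2 * ((1 : ℕ) + 2 : ℝ) * bump 2 w * w i)
      (g := fun w => fderiv ℝ f (z + ρ • w) (e i))
      (g' := fun w => ρ * fderiv ℝ (fderiv ℝ f) (z + ρ • w) (e i) (e i)) (v := e i)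
      (B := ContinuousLinearMap.mul ℝ ℝ) ?_ ?_ ?_ ?_ ?_
    · simp only [ContinuousLinearMap.mul_apply'] at this
      rw [this, ← integral_const_mul, ← integral_neg]
      congr 1 with w
      push_cast; ring
    · simp only [ContinuousLinearMap.mul_apply']
      refine ((hI1 i).const_mul (-6)).congr (Filter.Eventually.of_forall fun w => ?_)
      push_cast; ring
    · exact hI2 i
    · exact integrable_bump_mul three_ne_zero (hg i)
    · exact fun w _ => hasLineDerivAt_bump 1 w i
    · intro w hw
      have hy := hmaps (tsupport_bump_subset three_ne_zero hw)
      have h1 : HasFDerivAt (fderiv ℝ f) (fderiv ℝ (fderiv ℝ f) (z + ρ • w)) (z + ρ • w) :=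
        ((hd1.contDiffAt (Metric.isOpen_ball.mem_nhds hy)).differentiableAt
          (by norm_num)).hasFDerivAt
      have h2 : HasFDerivAt (fun w : Euc N => z + ρ • w) (ρ • ContinuousLinearMap.id ℝ _) w :=
        ((hasFDerivAt_id w).const_smul ρ).const_add z
      have h3 := ((h1.comp w h2).clm_apply (hasFDerivAt_const (e i) w)).hasLineDerivAt (e i)
      convert! h3 using 1
      simp
  have hsum : ∀ w : Euc N, bump 2 w * fderiv ℝ f (z + ρ • w) w
      = ∑ i, bump 2 w * (w i * fderiv ℝ f (z + ρ • w) (e i)) := fun w => by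
    rw [fderiv_apply_eq_sum, Finset.mul_sum]
  simp_rw [hsum]
  rw [integral_finsetSum _ fun i _ => hI1 i]
  have h6 : 6 * ∑ i, ∫ w : Euc N, bump 2 w * (w i * fderiv ℝ f (z + ρ • w) (e i)) = 0 := by
    rw [Finset.mul_sum, ← Finset.sum_congr rfl fun i _ => key i,
      ← integral_finsetSum _ fun i _ => hI2 i]
    refine integral_eq_zero_of_ae (Filter.Eventually.of_forall fun w => ?_)
    by_cases hw : w ∈ Metric.closedBall (0 : Euc N) 1
    · have := hf.2 _ (hmaps hw)
      simp only [d2, iteratedFDeriv_two_apply] at this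
      simp only [Pi.zero_apply]
      rw [← Finset.mul_sum, ← Finset.mul_sum]
      simp only [Matrix.cons_val_zero, Matrix.cons_val_one] at this
      rw [this]; simp
    · have : bump 3 w = 0 := by
        by_contra h
        exact hw (support_bump_subset three_ne_zero h)
      simp [this]
  linarith

/-- Mean value property of harmonic functions against a radial bump. -/
lemma integral_bump_mul_eq (hf : HarmonicOnE f (Metric.ball z R)) {ρ : ℝ}
    (hρ0 : 0 ≤ ρ) (hρ : ρ < R) :
    ∫ w : Euc N, bump 2 w * f (z + ρ • w) = (∫ w : Euc N, bump 2 w) * f z := by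
  have hcd : ∀ y ∈ Metric.ball z R, ContDiffAt ℝ 2 f y := fun y hy =>
    hf.1.contDiffAt (Metric.isOpen_ball.mem_nhds hy)
  have hdc : ContinuousOn (fderiv ℝ f) (Metric.ball z R) :=
    hf.1.continuousOn_fderiv_of_isOpen Metric.isOpen_ball (by norm_num)
  have hset : ∀ g : Euc N → ℝ, ∫ w : Euc N, bump 2 w * g w
      = ∫ w in Metric.closedBall (0 : Euc N) 1, bump 2 w * g w := fun g =>
    (setIntegral_eq_integral_of_forall_compl_eq_zero fun w hw => by
      have : bump 2 w = 0 := by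
        by_contra h
        exact hw (support_bump_subset two_ne_zero h)
      simp [this]).symm
  have hderiv : ∀ r ∈ Ioo (-R) R, HasDerivAt
      (fun r : ℝ => ∫ w : Euc N, bump 2 w * f (z + r • w)) 0 r := by
    intro r hr
    have hr' : |r| < R := abs_lt.2 hr
    obtain ⟨R', hrR', hR'⟩ := exists_between hr'
    obtain ⟨M, hM⟩ := (isCompact_closedBall z R').exists_bound_of_continuousOn
      (hdc.mono (Metric.closedBall_subset_ball hR'))
    rw [← integral_bump_mul_fderiv_eq_zero hf hr']
    simp_rw [hset]
    have hnhds : {x : ℝ | |x| < R'} ∈ nhds r :=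
      (isOpen_lt continuous_abs continuous_const).mem_nhds hrR'
    have hc : ∀ x : ℝ, |x| < R → ContinuousOn (fun w : Euc N => bump 2 w * f (z + x • w))
        (Metric.closedBall 0 1) := fun x hx =>
      (continuous_bump 2).continuousOn.mul (hf.1.continuousOn.comp (by fun_prop)
        fun w hw => add_smul_mem_ball hx hw)
    refine (hasDerivAt_integral_of_dominated_loc_of_deriv_le
      (F := fun x w => bump 2 w * f (z + x • w))
      (F' := fun x w => bump 2 w * fderiv ℝ f (z + x • w) w)
      (bound := fun _ => M) hnhds ?_ ?_ ?_ ?_ ?_ ?_).2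
    · filter_upwards [hnhds] with x hx
      exact (hc x (lt_trans hx hR')).aestronglyMeasurable measurableSet_closedBall
    · exact (hc r hr').integrableOn_compact (isCompact_closedBall _ _)
    · refine ContinuousOn.aestronglyMeasurable ?_ measurableSet_closedBall
      exact (continuous_bump 2).continuousOn.mul ((hdc.comp (by fun_prop)
        fun w hw => add_smul_mem_ball hr' hw).clm_apply continuousOn_id)
    · refine (ae_restrict_mem measurableSet_closedBall).mono fun w hw x hx => ?_
      have hb := hM (z + x • w) (Metric.ball_subset_closedBall (add_smul_mem_ball hx hw))
      have h1 := (fderiv ℝ f (z + x • w)).le_opNorm w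
      simp only [Metric.mem_closedBall, dist_zero_right] at hw
      rw [norm_mul, Real.norm_eq_abs (bump 2 w), abs_of_nonneg (bump_nonneg 2 w)]
      have h2 : ‖fderiv ℝ f (z + x • w)‖ * ‖w‖ ≤ M * 1 :=
        mul_le_mul hb hw (norm_nonneg _) ((norm_nonneg _).trans hb)
      nlinarith [bump_nonneg 2 w, bump_le_one 2 w, norm_nonneg (fderiv ℝ f (z + x • w) w)]
    · exact integrableOn_const (by simp [isCompact_closedBall _ _ |>.measure_ne_top])
    · refine (ae_restrict_mem measurableSet_closedBall).mono fun w hw x hx => ?_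
      have hy := add_smul_mem_ball (z := z) (lt_trans hx hR') hw
      have h1 := ((hcd _ hy).differentiableAt (by norm_num)).hasFDerivAt
      have h2 : HasDerivAt (fun x : ℝ => z + x • w) w x := by
        simpa using ((hasDerivAt_id x).smul_const w).const_add z
      exact (h1.comp_hasDerivAt x h2).const_mul _
  have hR : 0 < R := hρ0.trans_lt hρ
  have := isOpen_Ioo.is_const_of_deriv_eq_zero (isPreconnected_Ioo (a := -R) (b := R))
    (fun r hr => (hderiv r hr).differentiableAt.differentiableWithinAt)
    (fun r hr => (hderiv r hr).deriv) (x := ρ) (y := 0) ⟨by linarith, hρ⟩ ⟨by linarith, hR⟩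
  rw [this]
  simp [integral_mul_const]

end MeanValue

lemma HarmonicOnE.mono {N : ℕ} {f : Euc N → ℝ} {s t : Set (Euc N)} (hf : HarmonicOnE f t)
    (hst : s ⊆ t) : HarmonicOnE f s :=
  ⟨hf.1.mono hst, fun z hz => hf.2 z (hst hz)⟩

lemma setIntegral_closedBall_comp_add_smul {N : ℕ} (g : Euc N → ℝ) (z : Euc N) {ρ : ℝ}
    (hρ : 0 < ρ) :
    ∫ w in Metric.closedBall (0 : Euc N) 1, g (z + ρ • w)
      = (ρ ^ N)⁻¹ * ∫ y in Metric.closedBall z ρ, g y := by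
  have h1 := Measure.setIntegral_comp_smul_of_pos (volume : Measure (Euc N))
    (fun w => g (z + w)) (Metric.closedBall (0 : Euc N) 1) hρ
  rw [h1, finrank_euclideanSpace_fin, smul_eq_mul, smul_unitClosedBall_of_nonneg hρ.le]
  congr 1
  have h2 := (measurePreserving_add_left (volume : Measure (Euc N)) z).setIntegral_preimage_emb
    (measurableEmbedding_addLeft z) g (Metric.closedBall z ρ)
  rw [← h2]
  congr 2
  ext w
  simp [dist_eq_norm]

lemma integral_bump_pos (N : ℕ) : 0 < ∫ w : Euc N, bump 2 w := by
  have hc : HasCompactSupport (bump 2 : Euc N → ℝ) :=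
    HasCompactSupport.of_support_subset_isCompact (isCompact_closedBall 0 1)
      (support_bump_subset two_ne_zero)
  exact (continuous_bump 2).integral_pos_of_hasCompactSupport_nonneg_nonzero hc
    (fun w => bump_nonneg 2 w) (x := 0) (by simp [bump])

/-- A harmonic function is controlled at a point by its mean over a ball. -/
lemma exists_abs_mul_pow_le_setIntegral (N : ℕ) :
    ∃ C : ℝ, 0 < C ∧ ∀ (f : Euc N → ℝ) (z : Euc N) (R ρ : ℝ),
      HarmonicOnE f (Metric.ball z R) → 0 < ρ → ρ < R →
      |f z| * ρ ^ N ≤ C * ∫ w in Metric.closedBall z ρ, |f w| := by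
  have hc := integral_bump_pos N
  refine ⟨(∫ w : Euc N, bump 2 w)⁻¹, inv_pos.2 hc, fun f z R ρ hf hρ hR => ?_⟩
  have h := integral_bump_mul_eq hf hρ.le hR
  have hset : ∫ w : Euc N, bump 2 w * f (z + ρ • w)
      = ∫ w in Metric.closedBall (0 : Euc N) 1, bump 2 w * f (z + ρ • w) :=
    (setIntegral_eq_integral_of_forall_compl_eq_zero fun w hw => by
      have : bump 2 w = 0 := by
        by_contra h
        exact hw (support_bump_subset two_ne_zero h)
      simp [this]).symm
  have hcont : ContinuousOn (fun w : Euc N => f (z + ρ • w)) (Metric.closedBall 0 1) :=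
    hf.1.continuousOn.comp (by fun_prop)
      fun w hw => add_smul_mem_ball (by rwa [abs_of_pos hρ]) hw
  have hle : |∫ w : Euc N, bump 2 w * f (z + ρ • w)|
      ≤ ∫ w in Metric.closedBall (0 : Euc N) 1, |f (z + ρ • w)| := by
    rw [hset, ← Real.norm_eq_abs]
    have hint : IntegrableOn (fun w : Euc N => |f (z + ρ • w)|) (Metric.closedBall 0 1) :=
      hcont.abs.integrableOn_compact (isCompact_closedBall _ _)
    refine norm_integral_le_of_norm_le hint (Filter.Eventually.of_forall fun w => ?_)
    rw [norm_mul, Real.norm_eq_abs, Real.norm_eq_abs, abs_of_nonneg (bump_nonneg 2 w)]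
    exact mul_le_of_le_one_left (abs_nonneg _) (bump_le_one 2 w)
  rw [setIntegral_closedBall_comp_add_smul (fun y => |f y|) z hρ, h, abs_mul, abs_of_pos hc] at hle
  have hρN : 0 < ρ ^ N := pow_pos hρ N
  rw [← div_eq_inv_mul, le_div_iff₀ hρN] at hle
  rw [← div_eq_inv_mul, le_div_iff₀ hc]
  linarith

lemma exists_rpow_mul_pow_le_setIntegral_of_le_one {N : ℕ} (hN : 0 < N) {p : ℝ} (hp : 0 < p)
    (hp1 : p ≤ 1) :
    ∃ C : ℝ, 0 < C ∧ ∀ (f : Euc N → ℝ) (z : Euc N) (R r : ℝ),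
      HarmonicOnE f (Metric.ball z R) → 0 < r → r < R →
      |f z| ^ p * r ^ N ≤ C * ∫ w in Metric.closedBall z r, |f w| ^ p := by
  obtain ⟨C, hC, h⟩ := exists_abs_mul_pow_le_setIntegral N
  have hNp : 0 < (N : ℝ) / p := div_pos (by exact_mod_cast hN) hp
  set κ : ℝ := 2 ^ ((N : ℝ) / p) with hκ
  have hκ0 : 0 < κ := by positivity
  refine ⟨2 ^ N * C * κ ^ (1 - p), by positivity, fun f z R r hf hr hR => ?_⟩
  have hfc : ContinuousOn f (Metric.closedBall z r) :=
    hf.1.continuousOn.mono (Metric.closedBall_subset_ball hR)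
  have hpow : ContinuousOn (fun x => |f x| ^ p) (Metric.closedBall z r) :=
    hfc.abs.rpow_const fun _ _ => Or.inr hp.le
  have hI0 : 0 ≤ ∫ w in Metric.closedBall z r, |f w| ^ p :=
    integral_nonneg fun w => by positivity
  rcases eq_or_ne (f z) 0 with h0 | h0
  · rw [h0, abs_zero, zero_rpow hp.ne', zero_mul]; positivity
  have hMc : ContinuousOn (fun x => |f x| * (r - dist x z) ^ ((N : ℝ) / p))
      (Metric.closedBall z r) := by
    refine hfc.abs.mul (ContinuousOn.rpow_const (by fun_prop) fun _ _ => Or.inr hNp.le)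
  obtain ⟨x₀, hx₀, hmax⟩ := (isCompact_closedBall z r).exists_isMaxOn
    ⟨z, Metric.mem_closedBall_self hr.le⟩ hMc
  have hmax' : ∀ x ∈ Metric.closedBall z r, |f x| * (r - dist x z) ^ ((N : ℝ) / p)
      ≤ |f x₀| * (r - dist x₀ z) ^ ((N : ℝ) / p) := fun x hx => hmax hx
  set ε := r - dist x₀ z with hε
  have hz := hmax' z (Metric.mem_closedBall_self hr.le)
  rw [dist_self, sub_zero] at hz
  have hpos : 0 < |f x₀| * ε ^ ((N : ℝ) / p) :=
    lt_of_lt_of_le (mul_pos (abs_pos.2 h0) (rpow_pos_of_pos hr _)) hz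
  have hε0 : 0 < ε := by
    rcases (sub_nonneg.2 (Metric.mem_closedBall.1 hx₀) : 0 ≤ ε).eq_or_lt with h' | h'
    · rw [show ε = 0 from h'.symm, zero_rpow hNp.ne', mul_zero] at hpos
      exact absurd hpos (lt_irrefl _)
    · exact h'
  have hA : 0 < |f x₀| := by
    rcases (abs_nonneg (f x₀)).eq_or_lt with h' | h'
    · rw [← h', zero_mul] at hpos
      exact absurd hpos (lt_irrefl _)
    · exact h'
  have hsub : Metric.closedBall x₀ (ε / 2) ⊆ Metric.closedBall z r :=
    Metric.closedBall_subset_closedBall' (by linarith)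
  have hball : Metric.ball x₀ ε ⊆ Metric.ball z R :=
    Metric.ball_subset_ball' (by linarith)
  have hmv := h f x₀ ε (ε / 2) (hf.mono hball) (by linarith) (by linarith)
  have hbd : ∀ x ∈ Metric.closedBall x₀ (ε / 2), |f x| ≤ (κ * |f x₀|) ^ (1 - p) * |f x| ^ p := by
    intro x hx
    have hxε : ε / 2 ≤ r - dist x z := by
      have := dist_triangle x x₀ z
      have := Metric.mem_closedBall.1 hx
      linarith
    have h1 : |f x| * (ε / 2) ^ ((N : ℝ) / p) ≤ |f x₀| * ε ^ ((N : ℝ) / p) :=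
      le_trans (by gcongr) (hmax' x (hsub hx))
    rw [div_rpow hε0.le zero_le_two, ← hκ, ← mul_div_assoc, div_le_iff₀ hκ0] at h1
    have h2 : |f x| ≤ κ * |f x₀| := by
      have := rpow_pos_of_pos hε0 ((N : ℝ) / p)
      refine le_of_mul_le_mul_right ?_ this
      linarith
    rcases (abs_nonneg (f x)).eq_or_lt with h' | h'
    · rw [← h', zero_rpow hp.ne', mul_zero]
    · calc |f x| = |f x| ^ (1 - p) * |f x| ^ p := by rw [← rpow_add h']; simp
        _ ≤ _ := by gcongr
  have hint : ∫ w in Metric.closedBall x₀ (ε / 2), |f w|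
      ≤ (κ * |f x₀|) ^ (1 - p) * ∫ w in Metric.closedBall z r, |f w| ^ p := by
    calc ∫ w in Metric.closedBall x₀ (ε / 2), |f w|
        ≤ ∫ w in Metric.closedBall x₀ (ε / 2), (κ * |f x₀|) ^ (1 - p) * |f w| ^ p := by
          refine setIntegral_mono_on ?_ ?_ measurableSet_closedBall hbd
          · exact (hfc.mono hsub).abs.integrableOn_compact (isCompact_closedBall _ _)
          · exact (continuousOn_const.mul (hpow.mono hsub)).integrableOn_compact
              (isCompact_closedBall _ _)
      _ = (κ * |f x₀|) ^ (1 - p) * ∫ w in Metric.closedBall x₀ (ε / 2), |f w| ^ p :=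
          integral_const_mul _ _
      _ ≤ _ := by
          refine mul_le_mul_of_nonneg_left ?_ (by positivity)
          refine setIntegral_mono_set (hpow.integrableOn_compact (isCompact_closedBall _ _)) ?_
            hsub.eventuallyLE
          exact Filter.Eventually.of_forall fun w => by positivity
  have hfin : |f x₀| ^ p * ε ^ N
      ≤ 2 ^ N * C * κ ^ (1 - p) * ∫ w in Metric.closedBall z r, |f w| ^ p := by
    have h1 := hmv.trans (mul_le_mul_of_nonneg_left hint hC.le)
    rw [mul_rpow hκ0.le hA.le, div_pow] at h1
    have h2 : |f x₀| = |f x₀| ^ (1 - p) * |f x₀| ^ p := by rw [← rpow_add hA]; simp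
    have h3 : 0 < |f x₀| ^ (1 - p) := rpow_pos_of_pos hA _
    refine le_of_mul_le_mul_left ?_ h3
    have h4 : |f x₀| ^ (1 - p) * (|f x₀| ^ p * ε ^ N) = 2 ^ N * (|f x₀| * (ε ^ N / 2 ^ N)) := by
      rw [← mul_assoc, ← h2]; field_simp
    rw [h4]
    refine (mul_le_mul_of_nonneg_left h1 (by positivity)).trans (le_of_eq ?_)
    ring
  refine le_trans ?_ hfin
  have h5 := rpow_le_rpow (by positivity) hz hp.le
  have e1 : ∀ t : ℝ, 0 ≤ t → (t ^ ((N : ℝ) / p)) ^ p = t ^ N := fun t ht => by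
    rw [← rpow_mul ht, div_mul_cancel₀ _ hp.ne', rpow_natCast]
  rwa [mul_rpow (abs_nonneg _) (by positivity), mul_rpow (abs_nonneg _) (by positivity),
    e1 _ hr.le, e1 _ hε0.le] at h5

lemma exists_rpow_mul_pow_le_setIntegral_of_one_le (N : ℕ) {p : ℝ} (hp1 : 1 ≤ p) :
    ∃ C : ℝ, 0 < C ∧ ∀ (f : Euc N → ℝ) (z : Euc N) (R r : ℝ),
      HarmonicOnE f (Metric.ball z R) → 0 < r → r < R →
      |f z| ^ p * r ^ N ≤ C * ∫ w in Metric.closedBall z r, |f w| ^ p := by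
  have hp : 0 < p := by linarith
  obtain ⟨C, hC, h⟩ := exists_abs_mul_pow_le_setIntegral N
  set V : ℝ := ∫ _ in Metric.closedBall (0 : Euc N) 1, (1 : ℝ) with hV
  have hV0 : 0 < V := by
    rw [hV, setIntegral_const, smul_eq_mul, mul_one]
    exact ENNReal.toReal_pos (Metric.measure_closedBall_pos _ _ one_pos).ne'
      (isCompact_closedBall _ _).measure_ne_top
  set D : ℝ := 2 * C * V with hD
  have hD0 : 0 < D := by positivity
  refine ⟨2 * C * D ^ (p - 1), by positivity, fun f z R r hf hr hR => ?_⟩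
  have hfc : ContinuousOn f (Metric.closedBall z r) :=
    hf.1.continuousOn.mono (Metric.closedBall_subset_ball hR)
  have hpow : ContinuousOn (fun x => |f x| ^ p) (Metric.closedBall z r) :=
    hfc.abs.rpow_const fun _ _ => Or.inr hp.le
  have hI0 : 0 ≤ ∫ w in Metric.closedBall z r, |f w| ^ p :=
    integral_nonneg fun w => by positivity
  rcases eq_or_ne (f z) 0 with h0 | h0
  · rw [h0, abs_zero, zero_rpow hp.ne', zero_mul]; positivity
  have hA : 0 < |f z| := abs_pos.2 h0
  set l := |f z| / D with hl
  have hl0 : 0 < l := by positivity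
  have hrN : 0 < r ^ N := pow_pos hr N
  have hyoung : ∀ a : ℝ, 0 ≤ a → a ≤ l + l ^ (1 - p) * a ^ p := by
    intro a ha
    rcases le_total a l with h' | h'
    · have : 0 ≤ l ^ (1 - p) * a ^ p := by positivity
      linarith
    · have ha' : 0 < a := hl0.trans_le h'
      have h1 : a ^ (1 - p) ≤ l ^ (1 - p) :=
        rpow_le_rpow_of_nonpos hl0 h' (by linarith)
      have h2 : a = a ^ (1 - p) * a ^ p := by rw [← rpow_add ha']; simp
      have h3 : a ^ (1 - p) * a ^ p ≤ l ^ (1 - p) * a ^ p := by gcongr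
      linarith
  have hvol : ∫ _ in Metric.closedBall z r, l = l * (V * r ^ N) := by
    have := setIntegral_closedBall_comp_add_smul (fun _ => (1 : ℝ)) z hr
    rw [← hV] at this
    rw [this]
    simp only [setIntegral_const, smul_eq_mul, mul_one]
    field_simp
  have hint : ∫ w in Metric.closedBall z r, |f w|
      ≤ l * (V * r ^ N) + l ^ (1 - p) * ∫ w in Metric.closedBall z r, |f w| ^ p := by
    rw [← hvol, ← integral_const_mul, ← integral_add]
    · refine setIntegral_mono_on ?_ ?_ measurableSet_closedBall fun w _ => hyoung _ (abs_nonneg _)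
      · exact hfc.abs.integrableOn_compact (isCompact_closedBall _ _)
      · exact (continuousOn_const.add (continuousOn_const.mul hpow)).integrableOn_compact
          (isCompact_closedBall _ _)
    · exact continuousOn_const.integrableOn_compact (isCompact_closedBall _ _)
    · exact (continuousOn_const.mul hpow).integrableOn_compact (isCompact_closedBall _ _)
  have h1 := (h f z R r hf hr hR).trans (mul_le_mul_of_nonneg_left hint hC.le)
  have h2 : C * (l * (V * r ^ N)) = |f z| * r ^ N / 2 := by
    rw [hl, hD]; field_simp
  rw [mul_add, h2] at h1
  have h3 : l ^ (1 - p) = |f z| ^ (1 - p) * D ^ (p - 1) := by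
    rw [hl, div_rpow hA.le hD0.le, div_eq_mul_inv, ← rpow_neg hD0.le, neg_sub]
  have h4 : |f z| = |f z| ^ (1 - p) * |f z| ^ p := by rw [← rpow_add hA]; simp
  have h5 : 0 < |f z| ^ (1 - p) := rpow_pos_of_pos hA _
  refine le_of_mul_le_mul_left ?_ h5
  rw [← mul_assoc, ← h4]
  rw [h3] at h1
  linarith

/-- `|f|^p` satisfies a sub-mean value property, for every positive exponent `p`. -/
lemma exists_rpow_mul_pow_le_setIntegral {N : ℕ} (hN : 0 < N) {p : ℝ} (hp : 0 < p) :
    ∃ C : ℝ, 0 < C ∧ ∀ (f : Euc N → ℝ) (z : Euc N) (R r : ℝ),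
      HarmonicOnE f (Metric.ball z R) → 0 < r → r < R →
      |f z| ^ p * r ^ N ≤ C * ∫ w in Metric.closedBall z r, |f w| ^ p :=
  (le_total p 1).elim (exists_rpow_mul_pow_le_setIntegral_of_le_one hN hp)
    (exists_rpow_mul_pow_le_setIntegral_of_one_le N)

section HalfSpace

variable {n : ℕ}

@[simp] lemma tp_pt (x : Euc n) (t : ℝ) : tp (pt x t) = t := by
  simp [tp, pt, EuclideanSpace.equiv]

@[simp] lemma pt_castSucc (x : Euc n) (t : ℝ) (i : Fin n) : pt x t i.castSucc = x i := by
  simp [pt, EuclideanSpace.equiv]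

@[simp] lemma pt_last (x : Euc n) (t : ℝ) : pt x t (Fin.last n) = t := tp_pt x t

@[simp] lemma xp_apply (z : Euc (n + 1)) (i : Fin n) : xp z i = z i.castSucc := by
  simp [xp, EuclideanSpace.equiv]

lemma continuous_tp : Continuous (tp : Euc (n + 1) → ℝ) := by
  unfold tp; fun_prop

lemma isOpen_upperHS : IsOpen (upperHS n) :=
  isOpen_lt continuous_const continuous_tp

lemma continuous_pt : Continuous fun zt : Euc n × ℝ => pt zt.1 zt.2 := by
  unfold pt
  refine (ContinuousLinearEquiv.continuous _).comp (continuous_pi fun i => ?_)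
  refine Fin.lastCases ?_ (fun j => ?_) i
  · simpa using continuous_snd
  · simp only [Fin.snoc_castSucc]; fun_prop

lemma injective_pt : Function.Injective fun zt : Euc n × ℝ => pt zt.1 zt.2 := by
  rintro ⟨x, t⟩ ⟨y, s⟩ h
  simp only at h
  refine Prod.ext ?_ ?_
  · ext i
    simpa using congrArg (fun z : Euc (n + 1) => z i.castSucc) h
  · simpa using congrArg tp h

lemma measurePreserving_pt : MeasurePreserving (fun zt : Euc n × ℝ => pt zt.1 zt.2)
    ((volume : Measure (Euc n)).prod (volume : Measure ℝ)) volume := by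
  have h1 : MeasurePreserving (Prod.map (MeasurableEquiv.toLp 2 (Fin n → ℝ)).symm id)
      ((volume : Measure (Euc n)).prod (volume : Measure ℝ))
      ((volume : Measure (Fin n → ℝ)).prod (volume : Measure ℝ)) :=
    (EuclideanSpace.volume_preserving_symm_measurableEquiv_toLp (Fin n)).prod
      (MeasurePreserving.id _)
  have h2 : MeasurePreserving Prod.swap
      ((volume : Measure (Fin n → ℝ)).prod (volume : Measure ℝ))
      ((volume : Measure ℝ).prod (volume : Measure (Fin n → ℝ))) := Measure.measurePreserving_swap
  have h3 := (volume_preserving_piFinSuccAbove (fun _ : Fin (n + 1) => ℝ) (Fin.last n)).symm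
  have h4 := (EuclideanSpace.volume_preserving_symm_measurableEquiv_toLp (Fin (n + 1))).symm
  have h := h4.comp ((h3.comp h2).comp h1)
  convert! h using 1
  ext zt i
  refine Fin.lastCases ?_ (fun j => ?_) i
  · simp
  · simp

/-- The weighted Bergman norm as an integral over the half space. -/
lemma normAp_eq_setLIntegral (f : Euc (n + 1) → ℝ) (p l : ℝ) :
    normAp n f p l
      = ∫⁻ z in upperHS n, ENNReal.ofReal (tp z ^ l) * ENNReal.ofReal (|f z| ^ p) := by
  have hd : Measurable fun zt : Euc n × ℝ => ENNReal.ofReal (zt.2 ^ l) := by fun_prop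
  unfold normAp mLam
  rw [lintegral_withDensity_eq_lintegral_mul_non_measurable _ hd
    (Filter.Eventually.of_forall fun _ => ENNReal.ofReal_lt_top)]
  have hr : (volume : Measure (Euc n)).prod ((volume : Measure ℝ).restrict (Ioi 0))
      = ((volume : Measure (Euc n)).prod (volume : Measure ℝ)).restrict
        ((fun zt : Euc n × ℝ => pt zt.1 zt.2) ⁻¹' upperHS n) := by
    have : (fun zt : Euc n × ℝ => pt zt.1 zt.2) ⁻¹' upperHS n = univ ×ˢ Ioi 0 := by
      ext zt; simp [upperHS]
    rw [this, ← Measure.prod_restrict, Measure.restrict_univ]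
  rw [hr, ← measurePreserving_pt.setLIntegral_comp_preimage_emb
    (continuous_pt.measurableEmbedding injective_pt)]
  simp

lemma isClosed_Qcube (y : Euc n) (s : ℝ) : IsClosed (Qcube y s) := by
  unfold Qcube
  simp only [ofPred_and, ofPred_forall]
  refine IsClosed.inter (isClosed_iInter fun i => isClosed_le (by fun_prop) continuous_const)
    (isClosed_le (continuous_tp.sub continuous_const).abs continuous_const)

lemma Qcube_subset_upperHS (y : Euc n) {s : ℝ} (hs : 0 < s) : Qcube y s ⊆ upperHS n := by
  intro z hz
  have := (abs_le.1 hz.2).1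
  show 0 < tp z
  linarith

lemma abs_apply_sub_le_dist {N : ℕ} (z w : Euc N) (i : Fin N) : |z i - w i| ≤ dist z w := by
  rw [dist_eq_norm]
  simpa using PiLp.norm_apply_le (z - w) i

lemma Qcube_mem_nhds {z : Euc (n + 1)} (hz : z ∈ upperHS n) :
    Qcube (xp z) (tp z) ∈ nhds z := by
  have hz' : 0 < tp z := hz
  refine Filter.mem_of_superset (Metric.closedBall_mem_nhds z (half_pos hz')) fun w hw => ?_
  have h := fun i => (abs_apply_sub_le_dist w z i).trans (Metric.mem_closedBall.1 hw)
  exact ⟨fun i => by simpa using h i.castSucc, h (Fin.last n)⟩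

lemma ball_subset_upperHS (z : Euc (n + 1)) : Metric.ball z (tp z) ⊆ upperHS n := by
  intro w hw
  have h := (abs_apply_sub_le_dist w z (Fin.last n)).trans_lt (Metric.mem_ball.1 hw)
  have := (abs_lt.1 h).1
  show 0 < w (Fin.last n)
  unfold tp at this
  linarith

lemma mem_Qcube_of_mem_closedBall {z w : Euc (n + 1)} (hz : z ∈ upperHS n)
    (hw : w ∈ Metric.closedBall z (tp z / 4)) :
    tp w ≤ 5 / 4 * tp z ∧ w ∈ upperHS n ∧ z ∈ Qcube (xp w) (tp w) := by
  have hz' : 0 < tp z := hz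
  have h := fun i => (abs_apply_sub_le_dist w z i).trans (Metric.mem_closedBall.1 hw)
  have hl : |tp w - tp z| ≤ tp z / 4 := h (Fin.last n)
  obtain ⟨h1, h2⟩ := abs_le.1 hl
  refine ⟨by linarith, ?_, fun i => ?_, ?_⟩
  · show 0 < tp w
    linarith
  · rw [abs_sub_comm, xp_apply]
    linarith [h i.castSucc]
  · rw [abs_sub_comm]
    linarith

lemma sigmaFinite_restrict_upperHS {μ : Measure (Euc (n + 1))}
    (hμ : ∀ (y : Euc n) (r : ℝ), 0 < r → μ (Qcube y r) < ∞) :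
    SigmaFinite (μ.restrict (upperHS n)) := by
  obtain ⟨t, hts, htc, hcov⟩ := TopologicalSpace.countable_cover_nhdsWithin
    (f := fun z => Qcube (xp z) (tp z)) (s := upperHS n)
    fun z hz => mem_nhdsWithin_of_mem_nhds (Qcube_mem_nhds hz)
  refine Measure.sigmaFinite_of_countable
    (S := insert (upperHS n)ᶜ ((fun z => Qcube (xp z) (tp z)) '' t))
    ((htc.image _).insert _) ?_ ?_
  · rintro s (rfl | ⟨z, hz, rfl⟩)
    · rw [Measure.restrict_apply isOpen_upperHS.measurableSet.compl]
      simp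
    · exact (Measure.restrict_apply_le _ _).trans_lt (hμ _ _ (hts hz))
  · rw [sUnion_insert, sUnion_image]
    exact eq_univ_of_forall fun z => (em (z ∈ upperHS n)).elim (fun h => Or.inr (hcov h)) Or.inl

lemma exists_ofReal_rpow_le_setLIntegral (n : ℕ) {p : ℝ} (hp : 0 < p) :
    ∃ C : ℝ, 0 < C ∧ ∀ f : Euc (n + 1) → ℝ, HarmonicOnE f (upperHS n) → ∀ z ∈ upperHS n,
      ENNReal.ofReal (|f z| ^ p) ≤ ENNReal.ofReal (C * (tp z ^ (n + 1))⁻¹) *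
        ∫⁻ w in Metric.closedBall z (tp z / 4), ENNReal.ofReal (|f w| ^ p) := by
  obtain ⟨C, hC, h⟩ := exists_rpow_mul_pow_le_setIntegral n.succ_pos hp
  refine ⟨C * 4 ^ (n + 1), by positivity, fun f hf z hz => ?_⟩
  have hz' : 0 < tp z := hz
  have h1 := h f z (tp z) (tp z / 4) (hf.mono (ball_subset_upperHS z)) (by linarith) (by linarith)
  have hc : ContinuousOn (fun w => |f w| ^ p) (Metric.closedBall z (tp z / 4)) :=
    (hf.1.continuousOn.mono ((Metric.closedBall_subset_ball (by linarith)).trans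
      (ball_subset_upperHS z))).abs.rpow_const fun _ _ => Or.inr hp.le
  rw [← ofReal_integral_eq_lintegral_ofReal (hc.integrableOn_compact (isCompact_closedBall _ _))
    (Filter.Eventually.of_forall fun w => by positivity), ← ENNReal.ofReal_mul (by positivity)]
  refine ENNReal.ofReal_le_ofReal ?_
  rw [div_pow, ← mul_div_assoc, div_le_iff₀ (by positivity), ← le_div_iff₀ (by positivity)] at h1
  refine h1.trans (le_of_eq ?_)
  simp only [Nat.succ_eq_add_one]
  field_simp

theorem lintegral_le_normAp_of_measure_Qcube_le {p : ℝ} (hp : 0 < p) {α : ℝ}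
    {μ : Measure (Euc (n + 1))} {C : ℝ} (hC : 0 < C)
    (hμ : ∀ (y : Euc n) (r : ℝ), 0 < r →
      μ (Qcube y r) ≤ ENNReal.ofReal (C * r ^ ((n : ℝ) + 1 + α))) :
    ∃ C' : ℝ, 0 < C' ∧ ∀ f : Euc (n + 1) → ℝ, HarmonicOnE f (upperHS n) →
      ∫⁻ z in upperHS n, ENNReal.ofReal (|f z| ^ p) ∂μ ≤
        ENNReal.ofReal C' * normAp n f p α := by
  obtain ⟨D, hD, h⟩ := exists_ofReal_rpow_le_setLIntegral n hp
  have hσ := sigmaFinite_restrict_upperHS (μ := μ)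
    fun y r hr => (hμ y r hr).trans_lt ENNReal.ofReal_lt_top
  have hHm : MeasurableSet (upperHS n) := isOpen_upperHS.measurableSet
  refine ⟨D * (5 / 4) ^ (n + 1) * C, by positivity, fun f hf => ?_⟩
  set G : Euc (n + 1) → ℝ≥0∞ := (upperHS n).indicator fun w => ENNReal.ofReal (|f w| ^ p) with hG
  have hGm : Measurable G := by
    have hc : ContinuousOn (fun w => ENNReal.ofReal (|f w| ^ p)) (upperHS n) :=
      ENNReal.continuous_ofReal.comp_continuousOn
        (hf.1.continuousOn.abs.rpow_const fun _ _ => Or.inr hp.le)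
    classical
    rw [hG, ← piecewise_eq_indicator]
    exact hc.measurable_piecewise continuousOn_const hHm
  set c : Euc (n + 1) → ℝ≥0∞ := fun w =>
    ENNReal.ofReal (D * (5 / 4) ^ (n + 1) * (tp w ^ (n + 1))⁻¹) with hc
  have htm : Measurable (tp : Euc (n + 1) → ℝ) := continuous_tp.measurable
  have hcm : Measurable c := by rw [hc]; fun_prop
  set S : Set (Euc (n + 1) × Euc (n + 1)) := {q | q.1 ∈ Qcube (xp q.2) (tp q.2)} with hS
  have hSm : MeasurableSet S := by
    have h1 : Continuous fun q : Euc (n + 1) × Euc (n + 1) => tp q.1 :=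
      continuous_tp.comp continuous_fst
    have h2 : Continuous fun q : Euc (n + 1) × Euc (n + 1) => tp q.2 :=
      continuous_tp.comp continuous_snd
    have : S = (⋂ i : Fin n, {q | |q.1 i.castSucc - q.2 i.castSucc| ≤ tp q.2 / 2}) ∩
        {q | |tp q.1 - tp q.2| ≤ tp q.2 / 2} := by
      ext q
      simp [hS, Qcube]
    rw [this]
    exact (IsClosed.inter (isClosed_iInter fun i => isClosed_le (by fun_prop) (by fun_prop))
      (isClosed_le (by fun_prop) (by fun_prop))).measurableSet
  have hpt : ∀ z ∈ upperHS n, ENNReal.ofReal (|f z| ^ p)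
      ≤ ∫⁻ w, S.indicator (fun q => c q.2 * G q.2) (z, w) := by
    intro z hz
    have hz' : 0 < tp z := hz
    refine (h f hf z hz).trans ?_
    rw [← lintegral_const_mul' _ _ ENNReal.ofReal_ne_top,
      ← lintegral_indicator measurableSet_closedBall]
    refine lintegral_mono fun w => ?_
    by_cases hw : w ∈ Metric.closedBall z (tp z / 4)
    · obtain ⟨h1, h2, h3⟩ := mem_Qcube_of_mem_closedBall hz hw
      have h2' : 0 < tp w := h2
      rw [indicator_of_mem hw, indicator_of_mem (show (z, w) ∈ S from h3)]
      simp only [hG, indicator_of_mem h2]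
      gcongr
      refine ENNReal.ofReal_le_ofReal ?_
      rw [mul_assoc]
      refine mul_le_mul_of_nonneg_left ?_ hD.le
      rw [← inv_pow, ← inv_pow, ← mul_pow]
      refine pow_le_pow_left₀ (by positivity) ?_ _
      rw [← div_eq_mul_inv, inv_le_comm₀ hz' (by positivity), inv_div]
      rw [div_le_iff₀ (by norm_num)]
      linarith
    · rw [indicator_of_notMem hw]
      exact zero_le
  calc ∫⁻ z in upperHS n, ENNReal.ofReal (|f z| ^ p) ∂μ
      ≤ ∫⁻ z in upperHS n, ∫⁻ w, S.indicator (fun q => c q.2 * G q.2) (z, w) ∂volume ∂μ :=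
        setLIntegral_mono' hHm hpt
    _ = ∫⁻ w, ∫⁻ z in upperHS n, S.indicator (fun q => c q.2 * G q.2) (z, w) ∂μ :=
        lintegral_lintegral_swap
          (Measurable.aemeasurable (((hcm.comp measurable_snd).mul
            (hGm.comp measurable_snd)).indicator hSm))
    _ ≤ ∫⁻ w in upperHS n, ENNReal.ofReal (D * (5 / 4) ^ (n + 1) * C) *
          (ENNReal.ofReal (tp w ^ α) * ENNReal.ofReal (|f w| ^ p)) := by
        rw [← lintegral_indicator hHm]
        refine lintegral_mono fun w => ?_
        by_cases hw : w ∈ upperHS n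
        · have hw' : 0 < tp w := hw
          have h1 : ∀ z, S.indicator (fun q => c q.2 * G q.2) (z, w)
              = (Qcube (xp w) (tp w)).indicator (fun _ => c w * G w) z := fun z => rfl
          simp_rw [h1]
          rw [lintegral_indicator_const (isClosed_Qcube _ _).measurableSet, indicator_of_mem hw]
          simp only [hG, indicator_of_mem hw, hc]
          calc _ ≤ ENNReal.ofReal (D * (5 / 4) ^ (n + 1) * (tp w ^ (n + 1))⁻¹) *
                ENNReal.ofReal (|f w| ^ p) * ENNReal.ofReal (C * tp w ^ ((n : ℝ) + 1 + α)) := by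
                gcongr
                exact (Measure.restrict_apply_le _ _).trans (hμ _ _ hw')
            _ = _ := by
                rw [← ENNReal.ofReal_mul (by positivity), ← ENNReal.ofReal_mul (by positivity),
                  ← ENNReal.ofReal_mul (by positivity), ← ENNReal.ofReal_mul (by positivity)]
                congr 1
                have : tp w ^ ((n : ℝ) + 1 + α) = tp w ^ (n + 1) * tp w ^ α := by
                  rw [rpow_add hw', ← rpow_natCast]; push_cast; rfl
                rw [this]
                field_simp
        · rw [indicator_of_notMem hw]
          have : ∀ z, S.indicator (fun q => c q.2 * G q.2) (z, w) = 0 := fun z => by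
            simp [indicator, hG, hw]
          simp [this]
    _ = _ := by
        rw [lintegral_const_mul' _ _ ENNReal.ofReal_ne_top, normAp_eq_setLIntegral]

end HalfSpace

lemma d2_eq_of_hasLineDerivAt {N : ℕ} {f g : Euc N → ℝ} {z v : Euc N} {a : ℝ}
    (hf : ContDiffAt ℝ 2 f z) (hg : ∀ᶠ y in nhds z, HasLineDerivAt ℝ f (g y) y v)
    (ha : HasLineDerivAt ℝ g a z v) : d2 f z v = a := by
  simp only [d2, iteratedFDeriv_two_apply, Matrix.cons_val_zero, Matrix.cons_val_one]
  have h1 : HasFDerivAt (fderiv ℝ f) (fderiv ℝ (fderiv ℝ f) z) z :=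
    ((hf.fderiv_right (m := 1) (by norm_num)).differentiableAt (by norm_num)).hasFDerivAt
  have h2 := (h1.clm_apply (hasFDerivAt_const v z)).hasLineDerivAt v
  have h3 : (fun y => fderiv ℝ f y v) =ᶠ[nhds z] g := by
    filter_upwards [hg, hf.eventually (by simp)] with y hy hfy
    exact ((hfy.differentiableAt (by norm_num)).hasFDerivAt.hasLineDerivAt v).unique hy
  have h4 := ha.congr_of_eventuallyEq h3
  simpa using h2.unique h4

lemma HarmonicOnE.comp_sub {N : ℕ} {f : Euc N → ℝ} {s t : Set (Euc N)} (hf : HarmonicOnE f t)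
    (a : Euc N) (hst : ∀ z ∈ s, z - a ∈ t) : HarmonicOnE (fun z => f (z - a)) s := by
  refine ⟨hf.1.comp (by fun_prop) hst, fun z hz => ?_⟩
  simp only [d2, iteratedFDeriv_comp_sub]
  exact hf.2 _ (hst z hz)

section Kelvin

variable {N : ℕ}

/-- The function `(yᵢ + I yⱼ) ^ k * ‖y‖ ^ (2c)`; for `c = 1 - k - N / 2` it is the Kelvin transform
of a harmonic polynomial. -/
def kelvin (i j : Fin N) (k : ℕ) (c : ℝ) (y : Euc N) : ℂ :=
  ((y i : ℂ) + y j * Complex.I) ^ k * (((‖y‖ ^ 2) ^ c : ℝ) : ℂ)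

/-- The partial derivative of `yᵢ + I yⱼ` in direction `l`. -/
def dirCoeff (i j l : Fin N) : ℂ :=
  (if i = l then 1 else 0) + (if j = l then 1 else 0) * Complex.I

lemma hasLineDerivAt_kelvin (i j l : Fin N) (k : ℕ) (c : ℝ) {y : Euc N} (hy : y ≠ 0) :
    HasLineDerivAt ℝ (kelvin i j (k + 1) c)
      ((k + 1) * dirCoeff i j l * kelvin i j k c y + 2 * c * y l * kelvin i j (k + 1) (c - 1) y)
      y (EuclideanSpace.single l 1) := by
  unfold HasLineDerivAt kelvin
  have hline : HasDerivAt (fun τ : ℝ => y + τ • (EuclideanSpace.single l 1 : Euc N))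
      (EuclideanSpace.single l 1) 0 := by
    simpa using ((hasDerivAt_id (0 : ℝ)).smul_const (EuclideanSpace.single l 1 : Euc N)).const_add y
  have hcoord : ∀ m : Fin N, HasDerivAt
      (fun τ : ℝ => ((y + τ • (EuclideanSpace.single l 1 : Euc N)) m : ℂ))
      (if m = l then 1 else 0) 0 := by
    intro m
    have := (((EuclideanSpace.proj m : Euc N →L[ℝ] ℝ).hasFDerivAt).comp_hasDerivAt 0
      hline).ofReal_comp
    convert! this using 1
    by_cases h : m = l <;> simp [h]
  have h1 := ((hcoord i).add ((hcoord j).mul_const Complex.I)).pow (k + 1)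
  have h2 := hline.norm_sq
  have hy0 : ‖y + (0 : ℝ) • (EuclideanSpace.single l 1 : Euc N)‖ ^ 2 ≠ 0 := by
    simpa using hy
  have h3 := (h2.rpow_const (p := c) (Or.inl hy0)).ofReal_comp
  convert! h1.mul h3 using 1
  simp [dirCoeff, EuclideanSpace.inner_single_right]
  ring

lemma contDiffAt_kelvin (i j : Fin N) (k : ℕ) (c : ℝ) {y : Euc N} (hy : y ≠ 0) :
    ContDiffAt ℝ 2 (kelvin i j k c) y := by
  unfold kelvin
  have hc : ∀ m : Fin N, ContDiffAt ℝ 2 (fun y : Euc N => (y m : ℂ)) y := fun m =>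
    (Complex.ofRealCLM.contDiff.comp (EuclideanSpace.proj m : Euc N →L[ℝ] ℝ).contDiff).contDiffAt
  have h1 : ContDiffAt ℝ 2 (fun y : Euc N => ((y i : ℂ) + y j * Complex.I) ^ k) y :=
    ((hc i).add ((hc j).mul contDiffAt_const)).pow k
  have h2 : ContDiffAt ℝ 2 (fun y : Euc N => (‖y‖ ^ 2) ^ c) y :=
    (contDiff_norm_sq ℝ).contDiffAt.rpow_const_of_ne (by simpa using hy)
  exact h1.mul (Complex.ofRealCLM.contDiff.contDiffAt.comp y h2)

lemma sum_dirCoeff_sq {i j : Fin N} (hij : i ≠ j) : ∑ l, dirCoeff i j l ^ 2 = 0 := by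
  have : ∀ l, dirCoeff i j l ^ 2 = (if i = l then 1 else 0) - (if j = l then 1 else 0) := by
    intro l
    unfold dirCoeff
    by_cases h1 : i = l
    · have h2 : j ≠ l := fun h => hij (h1.trans h.symm)
      simp [h1, h2]
    · by_cases h2 : j = l <;> simp [h1, h2]
  simp [this]

lemma sum_dirCoeff_mul (i j : Fin N) (y : Euc N) :
    ∑ l, dirCoeff i j l * (y l : ℂ) = (y i : ℂ) + y j * Complex.I := by
  simp only [dirCoeff, add_mul, Finset.sum_add_distrib, ite_mul, one_mul, zero_mul,
    Finset.sum_ite_eq, Finset.mem_univ, if_true]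
  ring

lemma sum_coord_sq (y : Euc N) : ∑ l, (y l : ℂ) ^ 2 = ((‖y‖ ^ 2 : ℝ) : ℂ) := by
  rw [EuclideanSpace.norm_sq_eq]
  push_cast
  exact Finset.sum_congr rfl fun l _ => by
    rw [Real.norm_eq_abs, ← Complex.ofReal_pow, ← Complex.ofReal_pow, sq_abs]

lemma kelvin_succ (i j : Fin N) (k : ℕ) (c : ℝ) (y : Euc N) :
    ((y i : ℂ) + y j * Complex.I) * kelvin i j k c y = kelvin i j (k + 1) c y := by
  unfold kelvin; ring

lemma norm_sq_mul_kelvin (i j : Fin N) (k : ℕ) (c : ℝ) {y : Euc N} (hy : y ≠ 0) :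
    ((‖y‖ ^ 2 : ℝ) : ℂ) * kelvin i j k (c - 1) y = kelvin i j k c y := by
  unfold kelvin
  have hy' : 0 < ‖y‖ ^ 2 := by positivity
  have h : (‖y‖ ^ 2) ^ c = ‖y‖ ^ 2 * (‖y‖ ^ 2) ^ (c - 1) := by
    rw [rpow_sub_one hy'.ne']; field_simp
  rw [h]
  push_cast
  ring

lemma harmonicOnE_kelvin {i j : Fin N} (hij : i ≠ j) (k : ℕ) {c : ℝ}
    (hc : c = 1 - (k + 2 : ℕ) - (N : ℝ) / 2) (L : ℂ →L[ℝ] ℝ) :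
    HarmonicOnE (fun y => L (kelvin i j (k + 2) c y)) {0}ᶜ := by
  refine ⟨fun y hy => (L.contDiff.contDiffAt.comp y
    (contDiffAt_kelvin i j (k + 2) c hy)).contDiffWithinAt, fun y hy => ?_⟩
  have hL : ∀ {F : Euc N → ℂ} {F' : ℂ} {w v : Euc N}, HasLineDerivAt ℝ F F' w v →
      HasLineDerivAt ℝ (fun y => L (F y)) (L F') w v := fun h => L.hasFDerivAt.comp_hasDerivAt _ h
  have hy0 : y ≠ 0 := hy
  have hsecond : ∀ l : Fin N, d2 (fun y => L (kelvin i j (k + 2) c y)) y (EuclideanSpace.single l 1)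
      = L (((k + 2) * (k + 1) * kelvin i j k c y) * dirCoeff i j l ^ 2
        + (4 * c * (k + 2) * kelvin i j (k + 1) (c - 1) y) * (dirCoeff i j l * y l)
        + 2 * c * kelvin i j (k + 2) (c - 1) y
        + 4 * c * (c - 1) * kelvin i j (k + 2) (c - 1 - 1) y * (y l : ℂ) ^ 2) := by
    intro l
    refine d2_eq_of_hasLineDerivAt (g := fun y => L (((k + 1 : ℕ) + 1) * dirCoeff i j l *
        kelvin i j (k + 1) c y + 2 * c * y l * kelvin i j (k + 2) (c - 1) y))
      (L.contDiff.contDiffAt.comp y (contDiffAt_kelvin i j (k + 2) c hy0)) ?_ ?_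
    · filter_upwards [isOpen_compl_singleton.mem_nhds hy] with w hw
      exact hL (hasLineDerivAt_kelvin i j l (k + 1) c hw)
    · refine hL ?_
      have h1 := hasLineDerivAt_kelvin i j l k c hy0
      have h2 := hasLineDerivAt_kelvin i j l (k + 1) (c - 1) hy0
      have h3 : HasLineDerivAt ℝ (fun y : Euc N => (y l : ℂ)) 1 y (EuclideanSpace.single l 1) := by
        have := (Complex.ofRealCLM.hasFDerivAt.comp y
          (EuclideanSpace.proj l : Euc N →L[ℝ] ℝ).hasFDerivAt).hasLineDerivAt
          (EuclideanSpace.single l 1)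
        convert! this using 1
        simp
      unfold HasLineDerivAt at h1 h2 h3 ⊢
      have h := (h1.const_mul (((k + 1 : ℕ) + 1) * dirCoeff i j l)).add
        ((h3.const_mul (2 * (c : ℂ))).mul h2)
      convert! h using 1
      simp only [zero_smul, add_zero]
      push_cast
      ring
  rw [Finset.sum_congr rfl fun l _ => hsecond l, ← map_sum]
  simp only [Finset.sum_add_distrib, ← Finset.mul_sum]
  rw [sum_dirCoeff_sq hij, sum_dirCoeff_mul, sum_coord_sq, Finset.sum_const, Finset.card_univ,
    Fintype.card_fin, nsmul_eq_mul]
  have e1 := kelvin_succ i j (k + 1) (c - 1) y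
  have e2 := norm_sq_mul_kelvin i j (k + 2) (c - 1) hy0
  have hcC : (c : ℂ) = 1 - (k + 2) - (N : ℂ) / 2 := by rw [hc]; push_cast; ring
  convert map_zero L using 2
  linear_combination (4 * c * (k + 2) : ℂ) * e1 + (4 * c * (c - 1) : ℂ) * e2
    + (4 * c * kelvin i j (k + 2) (c - 1) y : ℂ) * hcC

lemma norm_kelvin (i j : Fin N) (k : ℕ) (c : ℝ) (y : Euc N) :
    ‖kelvin i j k c y‖ = ‖(y i : ℂ) + y j * Complex.I‖ ^ k * (‖y‖ ^ 2) ^ c := by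
  unfold kelvin
  rw [norm_mul, norm_pow, Complex.norm_real, Real.norm_eq_abs, abs_of_nonneg (by positivity)]

lemma abs_apply_le_norm_add_mul_I (i j : Fin N) (y : Euc N) :
    |y i| ≤ ‖(y i : ℂ) + y j * Complex.I‖ := by
  simpa using Complex.abs_re_le_norm ((y i : ℂ) + y j * Complex.I)

lemma norm_add_mul_I_le {i j : Fin N} (hij : i ≠ j) (y : Euc N) :
    ‖(y i : ℂ) + y j * Complex.I‖ ≤ ‖y‖ := by
  rw [Complex.norm_add_mul_I, EuclideanSpace.norm_eq]
  refine Real.sqrt_le_sqrt ?_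
  have := Finset.sum_le_univ_sum_of_nonneg (s := {i, j}) (f := fun l => ‖y l‖ ^ 2)
    fun l => by positivity
  simpa [Finset.sum_pair hij] using this

lemma norm_kelvin_le {i j : Fin N} (hij : i ≠ j) (k : ℕ) (c : ℝ) {y : Euc N} (hy : y ≠ 0) :
    ‖kelvin i j k c y‖ ≤ ‖y‖ ^ (k + 2 * c) := by
  have hy' : 0 < ‖y‖ := norm_pos_iff.2 hy
  rw [norm_kelvin, rpow_add hy', rpow_mul hy'.le, rpow_natCast, rpow_two]
  gcongr
  exact norm_add_mul_I_le hij y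

lemma measurable_kelvin (i j : Fin N) (k : ℕ) (c : ℝ) : Measurable (kelvin i j k c) := by
  unfold kelvin
  fun_prop

end Kelvin

section TestFunctions

variable {n : ℕ}

lemma norm_sq_pt (x : Euc n) (t : ℝ) : ‖pt x t‖ ^ 2 = ‖x‖ ^ 2 + t ^ 2 := by
  simp [EuclideanSpace.norm_sq_eq, Fin.sum_univ_castSucc]

lemma pt_sub_pt (x y : Euc n) (t s : ℝ) : pt x t - pt y s = pt (x - y) (t - s) := by
  ext i
  refine Fin.lastCases ?_ (fun j => ?_) i <;> simp

lemma pt_smul (c : ℝ) (x : Euc n) (t : ℝ) : pt (c • x) (c * t) = c • pt x t := by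
  ext i
  refine Fin.lastCases ?_ (fun j => ?_) i <;> simp

/-- The kernel `t^α |(x, t + s)|^{-q}` on the half space. -/
def decayKernel (α q s : ℝ) (v : Euc n × ℝ) : ℝ≥0∞ :=
  (Ioi (0 : ℝ)).indicator (fun t => ENNReal.ofReal (t ^ α * ‖pt v.1 (t + s)‖ ^ (-q))) v.2

lemma measurable_decayKernel (α q s : ℝ) : Measurable (decayKernel (n := n) α q s) := by
  have h : Measurable fun v : Euc n × ℝ => pt v.1 (v.2 + s) :=
    continuous_pt.measurable.comp (f := fun v : Euc n × ℝ => (v.1, v.2 + s)) (by fun_prop)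
  have : decayKernel (n := n) α q s = {v : Euc n × ℝ | 0 < v.2}.indicator
      fun v => ENNReal.ofReal (v.2 ^ α * ‖pt v.1 (v.2 + s)‖ ^ (-q)) := rfl
  rw [this]
  refine Measurable.indicator ?_ (measurableSet_lt measurable_const measurable_snd)
  fun_prop

lemma decayKernel_smul (α q : ℝ) {s : ℝ} (hs : 0 < s) (v : Euc n × ℝ) :
    decayKernel α q s (s • v) = ENNReal.ofReal (s ^ (α - q)) * decayKernel α q 1 v := by
  obtain ⟨x, t⟩ := v
  unfold decayKernel
  simp only [Prod.smul_mk, smul_eq_mul]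
  by_cases ht : 0 < t
  · rw [indicator_of_mem (show s * t ∈ Ioi 0 from mul_pos hs ht),
      indicator_of_mem (show t ∈ Ioi 0 from ht), ← ENNReal.ofReal_mul (by positivity)]
    congr 1
    rw [show s * t + s = s * (t + 1) by ring, pt_smul, norm_smul, Real.norm_eq_abs, abs_of_pos hs,
      mul_rpow hs.le ht.le, mul_rpow hs.le (norm_nonneg _), sub_eq_add_neg, rpow_add hs]
    ring
  · rw [indicator_of_notMem (show t ∉ Ioi 0 from ht),
      indicator_of_notMem (show s * t ∉ Ioi 0 from fun h => ht (pos_of_mul_pos_right h hs.le)),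
      mul_zero]

lemma lintegral_decayKernel (α q : ℝ) {s : ℝ} (hs : 0 < s) :
    ∫⁻ v, decayKernel (n := n) α q s v ∂(volume.prod volume)
      = ENNReal.ofReal (s ^ ((n : ℝ) + 1 + α - q)) *
        ∫⁻ v, decayKernel (n := n) α q 1 v ∂(volume.prod volume) := by
  have hm := Measure.map_addHaar_smul
    ((volume : Measure (Euc n)).prod (volume : Measure ℝ)) hs.ne'
  have h1 : ∫⁻ v, decayKernel (n := n) α q s v
        ∂(Measure.map (s • ·) ((volume : Measure (Euc n)).prod (volume : Measure ℝ)))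
      = ∫⁻ v, decayKernel α q s (s • v) ∂(volume.prod volume) :=
    lintegral_map (measurable_decayKernel α q s) (measurable_const_smul s)
  rw [hm, lintegral_smul_measure] at h1
  simp_rw [decayKernel_smul α q hs] at h1
  rw [lintegral_const_mul' _ _ ENNReal.ofReal_ne_top] at h1
  have hfr : Module.finrank ℝ (Euc n × ℝ) = n + 1 := by simp
  rw [hfr, abs_of_pos (by positivity), smul_eq_mul] at h1
  have h2 : s ^ ((n : ℝ) + 1 + α - q) = s ^ (n + 1) * s ^ (α - q) := by
    rw [add_sub_assoc, rpow_add hs, ← rpow_natCast]; push_cast; rfl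
  rw [h2, ENNReal.ofReal_mul (by positivity), mul_assoc, ← h1, ← mul_assoc,
    ← ENNReal.ofReal_mul (by positivity), mul_inv_cancel₀ (by positivity), ENNReal.ofReal_one,
    one_mul]

lemma integrableOn_rpow_mul_one_add_rpow {α b : ℝ} (hα : -1 < α) (hb : α + 1 < b) :
    IntegrableOn (fun t : ℝ => t ^ α * (t + 1) ^ (-b)) (Ioi 0) := by
  have hmeas : Measurable fun t : ℝ => t ^ α * (t + 1) ^ (-b) := by fun_prop
  rw [← Ioc_union_Ioi_eq_Ioi zero_le_one]
  refine IntegrableOn.union ?_ ?_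
  · have h := (intervalIntegral.intervalIntegrable_rpow' (a := 0) (b := 1) hα)
    rw [intervalIntegrable_iff_integrableOn_Ioc_of_le zero_le_one] at h
    refine h.mono' hmeas.aestronglyMeasurable ?_
    refine (ae_restrict_mem measurableSet_Ioc).mono fun t ht => ?_
    have ht0 : 0 < t := ht.1
    rw [Real.norm_eq_abs, abs_of_nonneg (by positivity)]
    exact mul_le_of_le_one_right (by positivity)
      (rpow_le_one_of_one_le_of_nonpos (by linarith) (by linarith))
  · have h := integrableOn_Ioi_rpow_of_lt (a := α - b) (by linarith) one_pos
    refine h.mono' hmeas.aestronglyMeasurable ?_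
    refine (ae_restrict_mem measurableSet_Ioi).mono fun t ht => ?_
    have ht0 : 0 < t := lt_trans one_pos ht
    rw [Real.norm_eq_abs, abs_of_nonneg (by positivity), sub_eq_add_neg, rpow_add ht0]
    exact mul_le_mul_of_nonneg_left
      (rpow_le_rpow_of_nonpos ht0 (by linarith) (by linarith)) (by positivity)

lemma lintegral_decayKernel_one_lt_top {α q : ℝ} (hα : -1 < α) (hq : 2 * n < q)
    (hqα : 2 * (α + 1) < q) :
    ∫⁻ v, decayKernel (n := n) α q 1 v ∂(volume.prod volume) < ∞ := by
  have hq0 : 0 < q := by linarith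
  set A : Euc n → ℝ≥0∞ := fun x => ENNReal.ofReal ((1 + ‖x‖ ^ 2) ^ (-(q / 2) / 2)) with hA
  set B : ℝ → ℝ≥0∞ := (Ioi (0 : ℝ)).indicator
    fun t => ENNReal.ofReal (t ^ α * (t + 1) ^ (-(q / 2))) with hB
  have hAm : Measurable A := by rw [hA]; fun_prop
  have hBm : Measurable B := Measurable.indicator (by fun_prop) measurableSet_Ioi
  have hle : ∀ v : Euc n × ℝ, decayKernel α q 1 v ≤ A v.1 * B v.2 := by
    rintro ⟨x, t⟩
    unfold decayKernel
    simp only [hA, hB]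
    by_cases ht : t ∈ Ioi (0 : ℝ)
    · rw [indicator_of_mem ht, indicator_of_mem ht, ← ENNReal.ofReal_mul (by positivity)]
      refine ENNReal.ofReal_le_ofReal ?_
      have ht0 : (0 : ℝ) < t := ht
      have h0 : ‖pt x (t + 1)‖ ^ 2 = ‖x‖ ^ 2 + (t + 1) ^ 2 := norm_sq_pt _ _
      have h1 : 1 + ‖x‖ ^ 2 ≤ ‖pt x (t + 1)‖ ^ 2 := by nlinarith
      have h2 : (t + 1) ^ 2 ≤ ‖pt x (t + 1)‖ ^ 2 := by nlinarith [sq_nonneg ‖x‖]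
      have hU : 0 < ‖pt x (t + 1)‖ ^ 2 := lt_of_lt_of_le (by positivity) h2
      have h3 : ‖pt x (t + 1)‖ ^ (-q)
          = (‖pt x (t + 1)‖ ^ 2) ^ (-(q / 2) / 2) * (‖pt x (t + 1)‖ ^ 2) ^ (-(q / 2) / 2) := by
        rw [← rpow_add hU, ← rpow_two, ← rpow_mul (norm_nonneg _)]
        congr 1; ring
      have h4 : (t + 1) ^ (-(q / 2)) = ((t + 1) ^ 2) ^ (-(q / 2) / 2) := by
        rw [← rpow_two, ← rpow_mul (by positivity)]
        congr 1; ring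
      have h5 : (‖pt x (t + 1)‖ ^ 2) ^ (-(q / 2) / 2) ≤ (1 + ‖x‖ ^ 2) ^ (-(q / 2) / 2) :=
        rpow_le_rpow_of_nonpos (by positivity) h1 (by linarith)
      have h6 : (‖pt x (t + 1)‖ ^ 2) ^ (-(q / 2) / 2) ≤ ((t + 1) ^ 2) ^ (-(q / 2) / 2) :=
        rpow_le_rpow_of_nonpos (by positivity) h2 (by linarith)
      rw [h3, h4]
      calc _ ≤ t ^ α * ((1 + ‖x‖ ^ 2) ^ (-(q / 2) / 2) * ((t + 1) ^ 2) ^ (-(q / 2) / 2)) := by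
            gcongr
        _ = _ := by ring
    · rw [indicator_of_notMem ht]
      exact zero_le
  refine (lintegral_mono hle).trans_lt ?_
  rw [lintegral_prod_mul hAm.aemeasurable hBm.aemeasurable]
  refine ENNReal.mul_lt_top ?_ ?_
  · have h : Integrable (fun x : Euc n => (1 + ‖x‖ ^ 2) ^ (-(q / 2) / 2)) :=
      integrable_rpow_neg_one_add_norm_sq (by
        rw [finrank_euclideanSpace_fin]; linarith)
    exact h.lintegral_lt_top
  · rw [hB, lintegral_indicator measurableSet_Ioi]
    exact (integrableOn_rpow_mul_one_add_rpow hα (by linarith)).lintegral_lt_top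

/-- Functions with decay `|z - w̄|^{-σ}` have a controlled Bergman norm. -/
lemma normAp_le_of_abs_le {f : Euc (n + 1) → ℝ} {p α σ : ℝ} (hp : 0 < p) (y : Euc n) {s : ℝ}
    (hs : 0 < s) (hf : ∀ z ∈ upperHS n, |f z| ≤ ‖z - pt y (-s)‖ ^ (-σ)) :
    normAp n f p α ≤ ENNReal.ofReal (s ^ ((n : ℝ) + 1 + α - σ * p)) *
      ∫⁻ v, decayKernel (n := n) α (σ * p) 1 v ∂(volume.prod volume) := by
  have hd : Measurable fun zt : Euc n × ℝ => ENNReal.ofReal (zt.2 ^ α) := by fun_prop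
  have hr : (volume : Measure (Euc n)).prod ((volume : Measure ℝ).restrict (Ioi 0))
      = ((volume : Measure (Euc n)).prod (volume : Measure ℝ)).restrict (univ ×ˢ Ioi 0) := by
    rw [← Measure.prod_restrict, Measure.restrict_univ]
  have hS : MeasurableSet ((univ : Set (Euc n)) ×ˢ Ioi (0 : ℝ)) :=
    MeasurableSet.univ.prod measurableSet_Ioi
  rw [← lintegral_decayKernel α (σ * p) hs,
    ← lintegral_sub_right_eq_self (decayKernel α (σ * p) s) ((y, 0) : Euc n × ℝ)]
  unfold normAp mLam
  rw [lintegral_withDensity_eq_lintegral_mul_non_measurable _ hd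
    (Filter.Eventually.of_forall fun _ => ENNReal.ofReal_lt_top), hr, ← lintegral_indicator hS]
  refine lintegral_mono ?_
  rintro ⟨x, t⟩
  by_cases ht : 0 < t
  · rw [indicator_of_mem (show (x, t) ∈ (univ : Set (Euc n)) ×ˢ Ioi (0 : ℝ) from ⟨mem_univ _, ht⟩)]
    simp only [decayKernel, Prod.mk_sub_mk, sub_zero, Pi.mul_apply]
    rw [indicator_of_mem (show t ∈ Ioi 0 from ht), ← ENNReal.ofReal_mul (by positivity)]
    refine ENNReal.ofReal_le_ofReal (mul_le_mul_of_nonneg_left ?_ (by positivity))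
    have h := hf (pt x t) (show 0 < tp (pt x t) by simpa using ht)
    rw [pt_sub_pt, sub_neg_eq_add] at h
    refine (rpow_le_rpow (abs_nonneg _) h hp.le).trans (le_of_eq ?_)
    rw [← rpow_mul (norm_nonneg _), neg_mul]
  · rw [indicator_of_notMem fun h => ht h.2]
    exact zero_le

lemma pt_neg_sub_ne_zero {z : Euc (n + 1)} (hz : z ∈ upperHS n) (y : Euc n) {s : ℝ} (hs : 0 < s) :
    z - pt y (-s) ≠ 0 := by
  intro h
  have h1 : tp z = tp (pt y (-s)) := congrArg tp (sub_eq_zero.1 h)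
  have hz' : 0 < tp z := hz
  rw [tp_pt] at h1
  linarith

lemma norm_sub_pt_neg_sq_le {z : Euc (n + 1)} {y : Euc n} {s : ℝ} (hz : z ∈ Qcube y s) :
    ‖z - pt y (-s)‖ ^ 2 ≤ (n + 7) * s ^ 2 := by
  have h1 : ∀ i : Fin n, ‖(z - pt y (-s)) i.castSucc‖ ^ 2 ≤ s ^ 2 / 4 := by
    intro i
    have h := hz.1 i
    rw [Real.norm_eq_abs, PiLp.sub_apply, pt_castSucc]
    nlinarith [abs_nonneg (z i.castSucc - y i)]
  have h2 : ‖(z - pt y (-s)) (Fin.last n)‖ ^ 2 ≤ 25 / 4 * s ^ 2 := by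
    obtain ⟨h3, h4⟩ := abs_le.1 hz.2
    rw [Real.norm_eq_abs, sq_abs, PiLp.sub_apply, pt_last, sub_neg_eq_add]
    change (tp z + s) ^ 2 ≤ _
    nlinarith
  rw [EuclideanSpace.norm_sq_eq, Fin.sum_univ_castSucc]
  have h3 := Finset.sum_le_sum fun i (_ : i ∈ Finset.univ) => h1 i
  rw [Finset.sum_const, Finset.card_univ, Fintype.card_fin, nsmul_eq_mul] at h3
  have h4 : 0 ≤ (n : ℝ) * s ^ 2 := by positivity
  nlinarith [sq_nonneg s]

lemma rpow_half_le_rpow_add_rpow {a b c p : ℝ} (hp : 0 < p) (ha : 0 ≤ a) (hb : 0 ≤ b)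
    (hc : 0 ≤ c) (h : c ≤ a + b) : (c / 2) ^ p ≤ a ^ p + b ^ p := by
  rcases le_total a b with hab | hab
  · have := rpow_le_rpow (by positivity) (show c / 2 ≤ b by linarith) hp.le
    have : 0 ≤ a ^ p := by positivity
    linarith
  · have := rpow_le_rpow (by positivity) (show c / 2 ≤ a by linarith) hp.le
    have : 0 ≤ b ^ p := by positivity
    linarith

theorem measure_Qcube_le_of_lintegral_le_normAp (hn : 1 ≤ n) {p : ℝ} (hp : 0 < p) {α : ℝ}
    (hα : -1 < α) {μ : Measure (Euc (n + 1))} {C : ℝ} (hC : 0 < C)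
    (h : ∀ f : Euc (n + 1) → ℝ, memAp n f p α →
      ∫⁻ z in upperHS n, ENNReal.ofReal (|f z| ^ p) ∂μ ≤ ENNReal.ofReal C * normAp n f p α) :
    ∃ C' : ℝ, 0 < C' ∧ ∀ (y : Euc n) (r : ℝ), 0 < r →
      μ (Qcube y r) ≤ ENNReal.ofReal (C' * r ^ ((n : ℝ) + 1 + α)) := by
  obtain ⟨k, hk⟩ := exists_nat_gt ((2 * n + 2 * (α + 1)) / p)
  rw [div_lt_iff₀ hp] at hk
  let i : Fin (n + 1) := Fin.last n
  let j : Fin (n + 1) := Fin.castSucc ⟨0, hn⟩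
  have hij : i ≠ j := (Fin.castSucc_lt_last _).ne'
  set c : ℝ := 1 - (k + 2 : ℕ) - ((n + 1 : ℕ) : ℝ) / 2 with hc
  set σ : ℝ := k + 1 + n with hσ
  have hkc : ((k + 2 : ℕ) : ℝ) + 2 * c = -σ := by rw [hc, hσ]; push_cast; ring
  have hn0 : (0 : ℝ) ≤ n := n.cast_nonneg
  have hσp : 2 * n + 2 * (α + 1) < σ * p := by
    rw [hσ]; nlinarith
  have hI := lintegral_decayKernel_one_lt_top (n := n) (q := σ * p) hα (by linarith) (by linarith)
  set I := ∫⁻ v, decayKernel (n := n) α (σ * p) 1 v ∂(volume.prod volume) with hIdef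
  have hκ : 0 < (((n : ℝ) + 7) ^ c / 2) ^ p := by positivity
  set κ : ℝ := (((n : ℝ) + 7) ^ c / 2) ^ p with hκdef
  have hI0 : 0 ≤ I.toReal := ENNReal.toReal_nonneg
  refine ⟨2 * C * I.toReal / κ + 1, by positivity, fun y r hr => ?_⟩
  set F : Euc (n + 1) → ℂ := fun z => kelvin i j (k + 2) c (z - pt y (-r)) with hF
  have hFm : Measurable F := (measurable_kelvin i j (k + 2) c).comp (measurable_id.sub_const _)
  have hFle : ∀ z ∈ upperHS n, ‖F z‖ ≤ ‖z - pt y (-r)‖ ^ (-σ) := fun z hz => by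
    rw [← hkc]
    exact norm_kelvin_le hij _ _ (pt_neg_sub_ne_zero hz y hr)
  have hlow : ∀ z ∈ Qcube y r, ((n : ℝ) + 7) ^ c * r ^ (-σ) ≤ ‖F z‖ := by
    intro z hz
    have h1 : r ≤ ‖(((z - pt y (-r)) i : ℝ) : ℂ) + ((z - pt y (-r)) j : ℝ) * Complex.I‖ := by
      refine le_trans ?_ (abs_apply_le_norm_add_mul_I i j _)
      refine le_trans ?_ (le_abs_self _)
      have h2 : 0 < tp z := Qcube_subset_upperHS y hr hz
      rw [PiLp.sub_apply, pt_last, sub_neg_eq_add]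
      change r ≤ tp z + r
      linarith
    have h3 : (((n : ℝ) + 7) * r ^ 2) ^ c ≤ (‖z - pt y (-r)‖ ^ 2) ^ c := by
      refine rpow_le_rpow_of_nonpos ?_ (norm_sub_pt_neg_sq_le hz) ?_
      · have := norm_pos_iff.2 (pt_neg_sub_ne_zero (Qcube_subset_upperHS y hr hz) y hr)
        positivity
      · rw [hc]; push_cast; linarith [(Nat.cast_nonneg k : (0 : ℝ) ≤ k)]
    rw [hF, norm_kelvin]
    calc ((n : ℝ) + 7) ^ c * r ^ (-σ) = r ^ (k + 2) * (((n : ℝ) + 7) * r ^ 2) ^ c := by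
          rw [← hkc, rpow_add hr, rpow_natCast, mul_rpow (by positivity) (by positivity),
            rpow_mul hr.le, rpow_two]
          ring
      _ ≤ _ := by gcongr
  have hest : ∀ L : ℂ →L[ℝ] ℝ, (∀ w, |L w| ≤ ‖w‖) →
      ∫⁻ z in upperHS n, ENNReal.ofReal (|L (F z)| ^ p) ∂μ
        ≤ ENNReal.ofReal (C * r ^ ((n : ℝ) + 1 + α - σ * p) * I.toReal) := by
    intro L hL
    have h1 : normAp n (fun z => L (F z)) p α
        ≤ ENNReal.ofReal (r ^ ((n : ℝ) + 1 + α - σ * p)) * I :=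
      normAp_le_of_abs_le hp y hr fun z hz => (hL _).trans (hFle z hz)
    have h2 : memAp n (fun z => L (F z)) p α :=
      ⟨(harmonicOnE_kelvin hij k hc L).comp_sub (pt y (-r))
        fun z hz => pt_neg_sub_ne_zero hz y hr,
        h1.trans_lt (ENNReal.mul_lt_top ENNReal.ofReal_lt_top hI)⟩
    refine (h _ h2).trans ((mul_le_mul_right h1 _).trans (le_of_eq ?_))
    rw [ENNReal.ofReal_mul (by positivity), ENNReal.ofReal_mul hC.le, ENNReal.ofReal_toReal hI.ne,
      mul_assoc]
  have hre := hest Complex.reCLM fun w => Complex.abs_re_le_norm w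
  have him := hest Complex.imCLM fun w => Complex.abs_im_le_norm w
  have hQ : ENNReal.ofReal (κ * r ^ (-(σ * p))) * μ (Qcube y r)
      ≤ ENNReal.ofReal (2 * (C * r ^ ((n : ℝ) + 1 + α - σ * p) * I.toReal)) := by
    have hm : Measurable fun z => ENNReal.ofReal (|Complex.reCLM (F z)| ^ p) := by
      have := Complex.reCLM.measurable.comp hFm
      fun_prop
    calc ENNReal.ofReal (κ * r ^ (-(σ * p))) * μ (Qcube y r)
        = ∫⁻ _ in Qcube y r, ENNReal.ofReal (κ * r ^ (-(σ * p))) ∂μ := by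
          rw [setLIntegral_const]
      _ ≤ ∫⁻ z in Qcube y r, (ENNReal.ofReal (|Complex.reCLM (F z)| ^ p)
            + ENNReal.ofReal (|Complex.imCLM (F z)| ^ p)) ∂μ := by
          refine setLIntegral_mono' (isClosed_Qcube y r).measurableSet fun z hz => ?_
          rw [← ENNReal.ofReal_add (by positivity) (by positivity)]
          refine ENNReal.ofReal_le_ofReal ?_
          have h1 := (hlow z hz).trans (Complex.norm_le_abs_re_add_abs_im (F z))
          have h2 := rpow_half_le_rpow_add_rpow hp (abs_nonneg _) (abs_nonneg _) (by positivity) h1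
          refine le_trans (le_of_eq ?_) h2
          rw [hκdef, mul_div_right_comm, mul_rpow (by positivity) (by positivity),
            ← rpow_mul hr.le, neg_mul]
      _ ≤ ∫⁻ z in upperHS n, (ENNReal.ofReal (|Complex.reCLM (F z)| ^ p)
            + ENNReal.ofReal (|Complex.imCLM (F z)| ^ p)) ∂μ :=
          lintegral_mono_set (Qcube_subset_upperHS y hr)
      _ ≤ _ := by
          rw [lintegral_add_left hm, two_mul, ENNReal.ofReal_add (by positivity) (by positivity)]
          exact add_le_add hre him
  have hpos : 0 < κ * r ^ (-(σ * p)) := by positivity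
  rw [mul_comm, ← ENNReal.le_div_iff_mul_le (Or.inl (by simpa using hpos)) (Or.inl (by simp)),
    ← ENNReal.ofReal_div_of_pos hpos] at hQ
  refine hQ.trans (ENNReal.ofReal_le_ofReal ?_)
  rw [div_le_iff₀ hpos, sub_eq_add_neg, rpow_add hr]
  have e : (2 * C * I.toReal / κ + 1) * r ^ ((n : ℝ) + 1 + α) * (κ * r ^ (-(σ * p)))
      = 2 * (C * (r ^ ((n : ℝ) + 1 + α) * r ^ (-(σ * p))) * I.toReal)
        + κ * (r ^ ((n : ℝ) + 1 + α) * r ^ (-(σ * p))) := by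
    field_simp
  rw [e]
  have : 0 ≤ κ * (r ^ ((n : ℝ) + 1 + α) * r ^ (-(σ * p))) := by positivity
  linarith

end TestFunctions

/-- Carleson measures for the weighted harmonic Bergman space A^p_α. -/
theorem stmt2 (n : ℕ) (hn : 2 ≤ n) (p : ℝ) (hp : 0 < p) (α : ℝ) (hα : -1 < α)
    (μ : Measure (Euc (n + 1))) :
    (∃ C : ℝ, 0 < C ∧ ∀ (y : Euc n) (r : ℝ), 0 < r →
        μ (Qcube y r) ≤ ENNReal.ofReal (C * r ^ ((n : ℝ) + 1 + α))) ↔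
    (∃ C' : ℝ, 0 < C' ∧ ∀ f : Euc (n + 1) → ℝ, memAp n f p α →
        (∫⁻ z in upperHS n, ENNReal.ofReal (|f z| ^ p) ∂μ) ≤
          ENNReal.ofReal C' * normAp n f p α) := by
  constructor
  · rintro ⟨C, hC, hμ⟩
    obtain ⟨C', hC', h⟩ := lintegral_le_normAp_of_measure_Qcube_le hp hC hμ
    exact ⟨C', hC', fun f hf => h f hf.1⟩
  · rintro ⟨C, hC, h⟩
    exact measure_Qcube_le_of_lintegral_le_normAp (by omega) hp hα hC h

end
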